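/- arXiv:2203.13543 — 2 statements merged into one kernel-verified Lean document; each statement's English description precedes it below -/
import Mathlib

section
/- Let σ be a word of length m with des(σ) = r and let π be a word of length n with des(π) = s, where σ and π are disjoint. Then for every k, the identity ∑_{α ∈ S(σ,π), des(α) = k} q^{maj(α)} = [m−r+s choose k−r]_q · [n−s+r choose k−s]_q · q^{maj(σ)+maj(π)+(k−s)(k−r)} holds as an identity of polynomials in q. -/
open Polynomial List

/-- The set of (1-indexed) descents of a word `w`: indices `i` with
`1 ≤ i ≤ length w - 1` and `w_i > w_{i+1}`. -/
def descents (w : List ℕ) : Finset ℕ :=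
  (Finset.Ico 1 w.length).filter (fun i => w.getD i 0 < w.getD (i - 1) 0)

/-- The number of descents of a word. -/
def des (w : List ℕ) : ℕ := (descents w).card

/-- The major index of a word: the sum of its descents. -/
def maj (w : List ℕ) : ℕ := ∑ i ∈ descents w, i

/-- `dge i w` is the number of descents of `w` that are `≥ i`. -/
def dge (i : ℕ) (w : List ℕ) : ℕ := ((descents w).filter (fun j => i ≤ j)).card

/-- `α` is a shuffle of the disjoint words `σ` and `π`. -/
def IsShuffle (σ π α : List ℕ) : Prop :=
  α.length = σ.length + π.length ∧ σ.Sublist α ∧ π.Sublist α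

/-- `ins σ i r` is `σ^{(i)}(r)`, the word obtained by inserting `r`
immediately before `σ_{i+1}` (after `σ_n` when `i = n`). -/
def ins (σ : List ℕ) (i r : ℕ) : List ℕ := σ.insertIdx i r

/-- The major increment `im(σ,i,r) = maj(σ^{(i)}(r)) - maj(σ)`. -/
def im (σ : List ℕ) (i r : ℕ) : ℤ := (maj (ins σ i r) : ℤ) - (maj σ : ℤ)

/-- The space `i` (for `0 ≤ i ≤ n`) is an RL-space of `σ` relative to `r`. -/
def IsRL (σ : List ℕ) (r i : ℕ) : Prop :=
  (i = σ.length ∧ ∀ x ∈ σ.getLast?, x < r) ∨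
  (i = 0 ∧ ∀ x ∈ σ.head?, r < x) ∨
  (0 < i ∧ i < σ.length ∧ r < σ.getD i 0 ∧ σ.getD i 0 < σ.getD (i - 1) 0) ∨
  (0 < i ∧ i < σ.length ∧ σ.getD i 0 < σ.getD (i - 1) 0 ∧ σ.getD (i - 1) 0 < r) ∨
  (0 < i ∧ i < σ.length ∧ σ.getD (i - 1) 0 < r ∧ r < σ.getD i 0)

/-- The Gaussian binomial coefficient `[N choose M]_q`, as a polynomial in `q`:
`∏_{j=1}^{M} (1 - q^{N-M+j}) / ∏_{j=1}^{M} (1 - q^{j})` when `0 ≤ M ≤ N`, and `0` otherwise. -/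
noncomputable def gauss (N M : ℤ) : Polynomial ℚ :=
  if 0 ≤ M ∧ M ≤ N then
    (∏ j ∈ Finset.Icc 1 M.toNat, (1 - (X : Polynomial ℚ) ^ (N - M + j).toNat)) /
      (∏ j ∈ Finset.Icc 1 M.toNat, (1 - (X : Polynomial ℚ) ^ (j : ℕ)))
  else 0

/-- `delPrefix α π i` is `α^{(i)}`: the word obtained from `α` by deleting
the letters `π₁, …, π_i`. -/
def delPrefix (α π : List ℕ) (i : ℕ) : List ℕ :=
  α.filter (fun x => !((π.take i).contains x))

/-! ### Gaussian binomials through the Pascal recursion -/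

noncomputable def gb : ℕ → ℕ → Polynomial ℚ
  | _, 0 => 1
  | 0, _ + 1 => 0
  | n + 1, m + 1 => gb n (m + 1) + X ^ (n - m) * gb n m

theorem gb_zero_right (n : ℕ) : gb n 0 = 1 := by cases n <;> rfl

theorem gb_of_lt : ∀ (n m : ℕ), n < m → gb n m = 0 := by
  intro n
  induction n with
  | zero => intro m h; cases m with
    | zero => omega
    | succ m => rfl
  | succ n ih => intro m h; cases m with
    | zero => omega
    | succ m => simp [gb, ih (m + 1) (by omega), ih m (by omega)]

theorem gb_prod (m d : ℕ) :
    gb (m + d) m * ∏ j ∈ Finset.range m, (1 - (X : Polynomial ℚ) ^ (j + 1)) =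
      ∏ j ∈ Finset.range m, (1 - (X : Polynomial ℚ) ^ (d + j + 1)) := by
  induction m generalizing d with
  | zero => simp [gb_zero_right]
  | succ m ihm =>
    induction d with
    | zero =>
      have h := ihm 0
      have e : gb (m + 1 + 0) (m + 1) = gb m m := by
        simp [gb, gb_of_lt m (m + 1) (by omega)]
      simp only [add_zero] at h
      rw [e, Finset.prod_range_succ, Finset.prod_range_succ, ← mul_assoc, h]
      simp
    | succ d ihd =>
      have h := ihm (d + 1)
      have e : gb (m + 1 + (d + 1)) (m + 1) =
          gb (m + 1 + d) (m + 1) + X ^ (d + 1) * gb (m + (d + 1)) m := by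
        have : m + 1 + (d + 1) = (m + 1 + d) + 1 := by omega
        rw [this, gb]
        have h1 : m + 1 + d = m + (d + 1) := by omega
        have h2 : m + 1 + d - m = d + 1 := by omega
        rw [h2, h1]
      have e2 : ∏ j ∈ Finset.range (m + 1), (1 - (X : Polynomial ℚ) ^ (d + j + 1)) =
          (∏ j ∈ Finset.range m, (1 - (X : Polynomial ℚ) ^ (d + 1 + j + 1))) *
            (1 - X ^ (d + 1)) := by
        rw [Finset.prod_range_succ']
        congr 1
        apply Finset.prod_congr rfl
        intro j _
        congr 2
        omega
      rw [e, add_mul, ihd, e2, Finset.prod_range_succ, Finset.prod_range_succ _ m, ← h]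
      ring

theorem prod_ne (m : ℕ) : ∏ j ∈ Finset.range m, (1 - (X : Polynomial ℚ) ^ (j + 1)) ≠ 0 := by
  rw [Finset.prod_ne_zero_iff]
  intro j _ h
  have := congrArg (Polynomial.eval 0) h
  simp at this

theorem gauss_nat (n m : ℕ) : gauss n m = gb n m := by
  unfold gauss
  split_ifs with h
  · obtain ⟨d, rfl⟩ : ∃ d, n = m + d := ⟨n - m, by omega⟩
    have key : ∀ f : ℕ → Polynomial ℚ,
        ∏ j ∈ Finset.Icc 1 m, f j = ∏ j ∈ Finset.range m, f (j + 1) := by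
      intro f
      rw [Finset.range_eq_Ico, Finset.prod_Ico_add' f 0 m 1]
      rfl
    rw [Int.toNat_natCast, key, key]
    have : ∏ j ∈ Finset.range m, (1 - (X : Polynomial ℚ) ^
        (((m + d : ℕ) : ℤ) - (m : ℤ) + ((j + 1 : ℕ) : ℤ)).toNat) =
        ∏ j ∈ Finset.range m, (1 - (X : Polynomial ℚ) ^ (d + j + 1)) := by
      apply Finset.prod_congr rfl
      intro j _
      congr 2
      omega
    rw [this, ← gb_prod]
    exact mul_div_cancel_right₀ _ (prod_ne m)
  · rw [gb_of_lt]; omega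

theorem gauss_neg (N M : ℤ) (h : M < 0) : gauss N M = 0 := by
  unfold gauss; rw [if_neg]; omega

theorem gauss_gt (N M : ℤ) (h : N < M) : gauss N M = 0 := by
  unfold gauss; rw [if_neg]; omega

theorem gauss_zero (N : ℤ) (h : 0 ≤ N) : gauss N 0 = 1 := by
  lift N to ℕ using h
  have := gauss_nat N 0
  simpa [gb_zero_right] using this

theorem gauss_self (N : ℤ) (h : 0 ≤ N) : gauss N N = 1 := by
  lift N to ℕ using h
  rw [gauss_nat]
  have := gb_prod N 0
  simp only [add_zero, zero_add] at this
  exact mul_right_cancel₀ (prod_ne N) (by rw [this, one_mul])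

theorem gauss_pascal (N M : ℤ) (hM : 1 ≤ M) (hN : M ≤ N) :
    gauss N M = gauss (N - 1) M + X ^ (N - M).toNat * gauss (N - 1) (M - 1) := by
  obtain ⟨a, rfl⟩ : ∃ a : ℕ, N = ((a + 1 : ℕ) : ℤ) := ⟨(N - 1).toNat, by omega⟩
  obtain ⟨b, rfl⟩ : ∃ b : ℕ, M = ((b + 1 : ℕ) : ℤ) := ⟨(M - 1).toNat, by omega⟩
  have e1 : ((a + 1 : ℕ) : ℤ) - 1 = (a : ℤ) := by omega
  have e2 : ((b + 1 : ℕ) : ℤ) - 1 = (b : ℤ) := by omega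
  have e3 : (((a + 1 : ℕ) : ℤ) - ((b + 1 : ℕ) : ℤ)).toNat = a - b := by omega
  rw [e1, e2, e3, gauss_nat, gauss_nat, gauss_nat, gb]

/-- The core algebraic identity. -/
theorem core (M N i j m : ℤ) (hm : m = M - i + j) (hM : 1 ≤ M) :
    gauss M i * gauss N j * X ^ (j * i).toNat =
      gauss (M - 1) i * gauss N j * X ^ (j * i).toNat +
        X ^ m.toNat * (gauss (M - 1) (i - 1) * gauss N j * X ^ (j * (i - 1)).toNat) := by
  rcases lt_or_ge j 0 with hj | hj
  · simp [gauss_neg N j hj]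
  rcases lt_or_ge i 1 with hi | hi
  · rw [gauss_neg (M - 1) (i - 1) (by omega)]
    rcases lt_or_eq_of_le (show i ≤ 0 by omega) with h | h
    · simp [gauss_neg _ i h]
    · subst h
      rw [gauss_zero _ (by omega), gauss_zero _ (by omega)]; simp
  rcases lt_or_ge M i with h | h
  · simp [gauss_gt M i h, gauss_gt (M - 1) i (by omega), gauss_gt (M - 1) (i - 1) (by omega)]
  rw [gauss_pascal M i hi h]
  have e : (X : Polynomial ℚ) ^ m.toNat * X ^ (j * (i - 1)).toNat =
      X ^ (M - i).toNat * X ^ (j * i).toNat := by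
    rw [← pow_add, ← pow_add]
    congr 1
    have h1 : 0 ≤ j * (i - 1) := mul_nonneg hj (by omega)
    have h2 : 0 ≤ j * i := mul_nonneg hj (by omega)
    zify
    rw [Int.toNat_of_nonneg h1, Int.toNat_of_nonneg h2, Int.toNat_of_nonneg (by omega),
      Int.toNat_of_nonneg (by omega), hm]
    ring
  linear_combination (-(gauss (M - 1) (i - 1) * gauss N j)) * e

noncomputable def Phi (m n r s k : ℤ) : Polynomial ℚ :=
  gauss (m - r + s) (k - r) * gauss (n - s + r) (k - s) * X ^ ((k - s) * (k - r)).toNat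

theorem Phi_symm (m n r s k : ℤ) : Phi m n r s k = Phi n m s r k := by
  unfold Phi
  rw [mul_comm (k - s) (k - r)]
  ring

theorem Phi_shift (m n r s k : ℤ) : Phi m n (r + 1) (s + 1) k = Phi m n r s (k - 1) := by
  unfold Phi
  congr 2 <;> ring_nf

theorem Phi_one (m n r s k : ℤ) (h : 1 ≤ m - r + s) :
    Phi m n r s k = Phi (m - 1) n r s k + X ^ m.toNat * Phi m (n - 1) (r + 1) s k := by
  have := core (m - r + s) (n - s + r) (k - r) (k - s) m (by ring) h
  unfold Phi
  rw [this]
  congr 4 <;> ring_nf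

theorem Phi_two (m n r s k : ℤ) (h : 1 ≤ n - s + r + 1) :
    Phi m n (r + 1) s k = X ^ n.toNat * Phi (m - 1) n r s (k - 1) + Phi m (n - 1) (r + 1) s k := by
  rw [Phi_symm m n, Phi_one n m s (r + 1) k (by omega), Phi_shift, Phi_symm (n - 1), Phi_symm n,
    add_comm]

theorem Phi_zero (n s k : ℤ) (hs : 0 ≤ s) (hn : s ≤ n) :
    Phi 0 n 0 s k = if s = k then 1 else 0 := by
  unfold Phi
  split_ifs with h
  · subst h
    simp [gauss_self s hs, gauss_zero (n - s) (by omega)]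
  · rcases lt_or_gt_of_ne h with h | h
    · rw [gauss_gt _ (k - 0) (by omega)]; simp
    · rw [gauss_neg _ (k - s) (by omega)]; simp

/-! ### Reversed words with a threshold -/

def desR : ℕ → List ℕ → ℕ
  | _, [] => 0
  | x, a :: w => (if x < a then 1 else 0) + desR a w

def majR : ℕ → List ℕ → ℕ
  | _, [] => 0
  | x, a :: w => (if x < a then w.length + 1 else 0) + majR a w

def shufR : List ℕ → List ℕ → Finset (List ℕ)
  | [], π => {π}
  | a :: σ, [] => {a :: σ}
  | a :: σ, b :: π => (shufR σ (b :: π)).image (fun α => a :: α) ∪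
      (shufR (a :: σ) π).image (fun α => b :: α)
termination_by σ π => σ.length + π.length

theorem desR_le (x : ℕ) (w : List ℕ) : desR x w ≤ w.length := by
  induction w generalizing x with
  | nil => simp [desR]
  | cons a w ih => have := ih a; simp only [desR, List.length_cons]; split_ifs <;> omega

theorem length_add_le : ∀ (α σ π : List ℕ), σ.Disjoint π → σ.Sublist α → π.Sublist α →
    σ.length + π.length ≤ α.length := by
  intro α
  induction α with
  | nil => intro σ π _ h1 h2; simp [List.sublist_nil.1 h1, List.sublist_nil.1 h2]
  | cons c α ih =>
    intro σ π hd h1 h2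
    rcases List.sublist_cons_iff.1 h1 with g1 | ⟨σ', rfl, g1⟩
    · rcases List.sublist_cons_iff.1 h2 with g2 | ⟨π', rfl, g2⟩
      · have := ih σ π hd g1 g2; simp; omega
      · have := ih σ π' (fun x hx hy => hd hx (List.mem_cons_of_mem _ hy)) g1 g2
        simp; omega
    · rcases List.sublist_cons_iff.1 h2 with g2 | ⟨π', rfl, g2⟩
      · have := ih σ' π (fun x hx hy => hd (List.mem_cons_of_mem _ hx) hy) g1 g2
        simp; omega
      · exact absurd (hd (a := c) (by simp) (by simp)) id

theorem mem_shufR : ∀ (σ π α : List ℕ), σ.Disjoint π → (α ∈ shufR σ π ↔ IsShuffle σ π α) := by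
  intro σ π
  induction σ, π using shufR.induct with
  | case1 π =>
    intro α _
    simp only [shufR, Finset.mem_singleton, IsShuffle, List.length_nil, zero_add,
      List.nil_sublist, true_and]
    constructor
    · rintro rfl; simp
    · rintro ⟨h1, h2⟩; exact (h2.eq_of_length h1.symm).symm
  | case2 a σ =>
    intro α _
    simp only [shufR, Finset.mem_singleton, IsShuffle, List.length_nil, add_zero,
      List.nil_sublist, and_true]
    constructor
    · rintro rfl; simp
    · rintro ⟨h1, h2⟩; exact (h2.eq_of_length h1.symm).symm
  | case3 a σ b π ih1 ih2 =>
    intro α hd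
    have hab : a ≠ b := by
      rintro rfl; exact hd (a := a) (by simp) (by simp)
    have hd1 : σ.Disjoint (b :: π) := fun x hx hy => hd (List.mem_cons_of_mem _ hx) hy
    have hd2 : (a :: σ).Disjoint π := fun x hx hy => hd hx (List.mem_cons_of_mem _ hy)
    simp only [shufR, Finset.mem_union, Finset.mem_image]
    constructor
    · rintro (⟨β, hβ, rfl⟩ | ⟨β, hβ, rfl⟩)
      · obtain ⟨h1, h2, h3⟩ := (ih1 β hd1).1 hβ
        exact ⟨by simp at h1 ⊢; omega, h2.cons_cons a, h3.cons a⟩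
      · obtain ⟨h1, h2, h3⟩ := (ih2 β hd2).1 hβ
        exact ⟨by simp at h1 ⊢; omega, h2.cons b, h3.cons_cons b⟩
    · rintro ⟨h1, h2, h3⟩
      cases α with
      | nil => simp at h1
      | cons c α =>
        rcases List.sublist_cons_iff.1 h2 with g2 | ⟨σ', e, g2⟩
        · rcases List.sublist_cons_iff.1 h3 with g3 | ⟨π', e, g3⟩
          · have := length_add_le _ _ _ hd g2 g3
            simp at this h1; omega
          · obtain ⟨rfl, rfl⟩ := List.cons.inj e
            exact Or.inr ⟨α, (ih2 α hd2).2 ⟨by simp at h1 ⊢; omega, g2, g3⟩, rfl⟩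
        · obtain ⟨rfl, rfl⟩ := List.cons.inj e
          rcases List.sublist_cons_iff.1 h3 with g3 | ⟨π', e, g3⟩
          · exact Or.inl ⟨α, (ih1 α hd1).2 ⟨by simp at h1 ⊢; omega, g2, g3⟩, rfl⟩
          · exact absurd (List.cons.inj e).1.symm hab

noncomputable def B (x : ℕ) (T : Finset (List ℕ)) (k : ℤ) : Polynomial ℚ :=
  ∑ α ∈ T, if (desR x α : ℤ) = k then (X : Polynomial ℚ) ^ majR x α else 0

theorem B_image (x a L : ℕ) (T : Finset (List ℕ)) (k : ℤ) (hT : ∀ α ∈ T, α.length = L) :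
    B x (T.image (fun α => a :: α)) k =
      if x < a then X ^ (L + 1) * B a T (k - 1) else B a T k := by
  unfold B
  rw [Finset.sum_image (by intro u _ v _ h; exact (List.cons.inj h).2)]
  split_ifs with h
  · rw [Finset.mul_sum]
    apply Finset.sum_congr rfl
    intro α hα
    simp only [desR, majR, if_pos h, hT α hα, pow_add]
    have : (((1 + desR a α : ℕ) : ℤ) = k) ↔ ((desR a α : ℤ) = k - 1) := by
      push_cast; constructor <;> intro h <;> linarith
    simp only [this]
    split_ifs <;> simp
  · apply Finset.sum_congr rfl
    intro α hα
    simp only [desR, majR, if_neg h, zero_add]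

theorem main_R : ∀ (σ π : List ℕ), σ.Disjoint π → ∀ (x : ℕ) (k : ℤ),
    B x (shufR σ π) k = Phi σ.length π.length (desR x σ) (desR x π) k *
      X ^ (majR x σ + majR x π) := by
  intro σ π
  induction σ, π using shufR.induct with
  | case1 π =>
    intro _ x k
    have := desR_le x π
    simp only [shufR, B, Finset.sum_singleton, List.length_nil, desR, majR, Nat.cast_zero]
    rw [Phi_zero _ _ _ (by omega) (by exact_mod_cast this)]
    split_ifs <;> simp
  | case2 a σ =>
    intro _ x k
    have := desR_le x (a :: σ)
    rw [Phi_symm]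
    simp only [shufR, B, Finset.sum_singleton, List.length_nil, desR.eq_1, majR.eq_1,
      Nat.cast_zero]
    rw [Phi_zero _ _ _ (by omega) (by exact_mod_cast this)]
    split_ifs <;> simp
  | case3 a σ b π ih1 ih2 =>
    intro hd x k
    have hab : a ≠ b := by
      rintro rfl; exact hd (a := a) (by simp) (by simp)
    have hd1 : σ.Disjoint (b :: π) := fun x hx hy => hd (List.mem_cons_of_mem _ hx) hy
    have hd2 : (a :: σ).Disjoint π := fun x hx hy => hd hx (List.mem_cons_of_mem _ hy)
    have hu : B x (shufR (a :: σ) (b :: π)) k =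
        B x ((shufR σ (b :: π)).image (fun α => a :: α)) k +
        B x ((shufR (a :: σ) π).image (fun α => b :: α)) k := by
      rw [shufR]
      unfold B
      apply Finset.sum_union
      rw [Finset.disjoint_left]
      intro α h1 h2
      simp only [Finset.mem_image] at h1 h2
      obtain ⟨u, _, rfl⟩ := h1
      obtain ⟨v, _, h⟩ := h2
      exact hab (List.cons.inj h).1.symm
    rw [hu, B_image x a (σ.length + π.length + 1) _ _
        (fun α hα => by have := ((mem_shufR _ _ _ hd1).1 hα).1; simp at this; omega),
      B_image x b (σ.length + π.length + 1) _ _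
        (fun α hα => by have := ((mem_shufR _ _ _ hd2).1 hα).1; simp at this; omega)]
    simp only [ih1 hd1, ih2 hd2]
    have hr := desR_le a σ
    have hs := desR_le b π
    simp only [desR, majR, List.length_cons]
    generalize desR a σ = r at *
    generalize desR b π = s at *
    generalize majR a σ = A at *
    generalize majR b π = C at *
    generalize σ.length = m at *
    generalize π.length = n at *
    have em : (((m + 1 : ℕ) : ℤ)).toNat = m + 1 := by omega
    have en : (((n + 1 : ℕ) : ℤ)).toNat = n + 1 := by omega
    have em' : ((m + 1 : ℕ) : ℤ) - 1 = m := by omega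
    have en' : ((n + 1 : ℕ) : ℤ) - 1 = n := by omega
    -- the identities when `b < a`, and when `a < b`
    have P1 : ∀ k, Phi ((m + 1 : ℕ) : ℤ) ((n + 1 : ℕ) : ℤ) r s k = _ :=
      fun k => Phi_one ((m + 1 : ℕ) : ℤ) ((n + 1 : ℕ) : ℤ) r s k (by omega)
    have P2 : ∀ k, Phi ((m + 1 : ℕ) : ℤ) ((n + 1 : ℕ) : ℤ) (r + 1) s k = _ :=
      fun k => Phi_two ((m + 1 : ℕ) : ℤ) ((n + 1 : ℕ) : ℤ) r s k (by omega)
    have Q1 : ∀ k, Phi ((n + 1 : ℕ) : ℤ) ((m + 1 : ℕ) : ℤ) s r k = _ :=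
      fun k => Phi_one ((n + 1 : ℕ) : ℤ) ((m + 1 : ℕ) : ℤ) s r k (by omega)
    have Q2 : ∀ k, Phi ((n + 1 : ℕ) : ℤ) ((m + 1 : ℕ) : ℤ) (s + 1) r k = _ :=
      fun k => Phi_two ((n + 1 : ℕ) : ℤ) ((m + 1 : ℕ) : ℤ) s r k (by omega)
    rw [em, em', en'] at P1 Q2
    rw [en, em', en'] at P2 Q1
    have c1 : ∀ t : ℕ, ((1 + t : ℕ) : ℤ) = (t : ℤ) + 1 := by intro t; omega
    rcases lt_or_gt_of_ne hab with hlt | hlt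
    · have h2 : ¬ b < a := by omega
      simp only [if_pos hlt, if_neg h2, c1, zero_add]
      rw [Phi_symm ((m + 1 : ℕ) : ℤ) ((n + 1 : ℕ) : ℤ)]
      by_cases hxa : x < a
      · have hxb : x < b := by omega
        simp only [if_pos hxa, if_pos hxb, c1]
        rw [Phi_shift, Q1 (k - 1), Phi_symm n, Phi_symm _ (m : ℤ)]
        ring
      · by_cases hxb : x < b
        · simp only [if_neg hxa, if_pos hxb, c1, zero_add]
          rw [Q2 k, Phi_symm n, Phi_symm _ (m : ℤ)]
          ring
        · simp only [if_neg hxa, if_neg hxb, zero_add]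
          rw [Q1 k, Phi_symm n, Phi_symm _ (m : ℤ)]
          ring
    · have h2 : ¬ a < b := by omega
      simp only [if_pos hlt, if_neg h2, c1, zero_add]
      by_cases hxb : x < b
      · have hxa : x < a := by omega
        simp only [if_pos hxa, if_pos hxb, c1]
        rw [Phi_shift, P1 (k - 1)]
        ring
      · by_cases hxa : x < a
        · simp only [if_pos hxa, if_neg hxb, c1, zero_add]
          rw [P2 k]
          ring
        · simp only [if_neg hxa, if_neg hxb, zero_add]
          rw [P1 k]
          ring

/-! ### Back to ordinary words -/

theorem descents_append (w : List ℕ) (a b : ℕ) :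
    descents (w ++ [a] ++ [b]) =
      if b < a then insert (w.length + 1) (descents (w ++ [a])) else descents (w ++ [a]) := by
  have hlt : ∀ i, i < w.length + 1 → (w ++ [a] ++ [b]).getD i 0 = (w ++ [a]).getD i 0 := by
    intro i hi
    exact List.getD_append _ _ _ _ (by simpa using hi)
  have h1 : (w ++ [a] ++ [b]).getD (w.length + 1) 0 = b := by
    rw [List.getD_append_right _ _ _ _ (by simp)]; simp
  have h2 : (w ++ [a] ++ [b]).getD (w.length + 1 - 1) 0 = a := by
    rw [hlt _ (by omega), List.getD_append_right _ _ _ _ (by simp)]; simp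
  have hmem : ∀ i, i ∈ descents (w ++ [a] ++ [b]) ↔
      (i = w.length + 1 ∧ b < a) ∨ i ∈ descents (w ++ [a]) := by
    intro i
    simp only [descents, Finset.mem_filter, Finset.mem_Ico]
    have l1 : (w ++ [a] ++ [b]).length = w.length + 2 := by simp
    have l2 : (w ++ [a]).length = w.length + 1 := by simp
    rw [l1, l2]
    rcases lt_trichotomy i (w.length + 1) with h | h | h
    · rw [hlt i h, hlt (i - 1) (by omega)]
      constructor
      · rintro ⟨h3, h4⟩; exact Or.inr ⟨by omega, h4⟩
      · rintro (h3 | ⟨h3, h4⟩)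
        · omega
        · exact ⟨by omega, h4⟩
    · subst h
      rw [h1, h2]
      constructor
      · rintro ⟨_, h4⟩; exact Or.inl ⟨rfl, h4⟩
      · rintro (h3 | ⟨h3, h4⟩)
        · exact ⟨by omega, h3.2⟩
        · omega
    · constructor
      · rintro ⟨h3, h4⟩; omega
      · rintro (h3 | ⟨h3, h4⟩) <;> omega
  ext i
  rw [hmem]
  split_ifs with h <;> simp [h]

theorem des_maj_append (w : List ℕ) (x : ℕ) :
    des (w.reverse ++ [x]) = desR x w ∧ maj (w.reverse ++ [x]) = majR x w := by
  induction w generalizing x with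
  | nil => simp [des, maj, descents, desR, majR]
  | cons a w ih =>
    have hn : w.reverse.length + 1 ∉ descents (w.reverse ++ [a]) := by
      simp [descents]
    obtain ⟨i1, i2⟩ := ih a
    rw [List.reverse_cons]
    simp only [des, maj, descents_append, desR, majR] at *
    split_ifs with h
    · rw [Finset.card_insert_of_notMem hn, Finset.sum_insert hn, i1, i2]
      simp [add_comm]
    · simp [i1, i2]

theorem des_maj_rev (w : List ℕ) (x : ℕ) (h : ∀ a ∈ w, a < x) :
    des w = desR x w.reverse ∧ maj w = majR x w.reverse := by
  have e := des_maj_append w.reverse x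
  rw [List.reverse_reverse] at e
  rw [← e.1, ← e.2]
  rcases List.eq_nil_or_concat w with rfl | ⟨v, a, rfl⟩
  · simp [des, maj, descents]
  · have : ¬ x < a := by have := h a (by simp); omega
    rw [List.concat_eq_append]
    simp only [des, maj, descents_append, this, if_false, and_self]

/-- **Stanley's Shuffle Theorem.** -/
theorem stanley_shuffle_theorem (m n r s k : ℕ) (σ π : List ℕ)
    (hσl : σ.length = m) (hπl : π.length = n) (hσnd : σ.Nodup) (hπnd : π.Nodup)
    (hdisj : σ.Disjoint π) (hr : des σ = r) (hs : des π = s)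
    (S : Finset (List ℕ)) (hS : ∀ α, α ∈ S ↔ IsShuffle σ π α) :
    ∑ α ∈ S.filter (fun α => des α = k), (X : Polynomial ℚ) ^ maj α =
      gauss ((m : ℤ) - r + s) ((k : ℤ) - r) * gauss ((n : ℤ) - s + r) ((k : ℤ) - s) *
        (X : Polynomial ℚ) ^ (maj σ + maj π) *
        (X : Polynomial ℚ) ^ ((((k : ℤ) - s) * ((k : ℤ) - r)).toNat) := by
  obtain ⟨x, hx⟩ : ∃ x : ℕ, ∀ a ∈ σ ++ π, a < x :=
    ⟨(σ ++ π).sum + 1, fun a ha => Nat.lt_succ_of_le (List.le_sum_of_mem ha)⟩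
  have hxs : ∀ a ∈ σ, a < x := fun a h => hx a (by simp [h])
  have hxp : ∀ a ∈ π, a < x := fun a h => hx a (by simp [h])
  have hd : σ.reverse.Disjoint π.reverse := by
    intro a h1 h2
    exact hdisj (List.mem_reverse.1 h1) (List.mem_reverse.1 h2)
  have hrev : ∀ α, α ∈ S ↔ α.reverse ∈ shufR σ.reverse π.reverse := by
    intro α
    rw [hS, mem_shufR _ _ _ hd]
    simp [IsShuffle]
  have hlet : ∀ α ∈ S, ∀ a ∈ α, a < x := by
    intro α hα
    obtain ⟨h1, h2, h3⟩ := (hS α).1 hα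
    by_contra hcon
    push Not at hcon
    obtain ⟨c, hc, hcx⟩ := hcon
    -- deleting `c` keeps both sublists, and contradicts the length
    have hcs : c ∉ σ := fun h => by have := hxs c h; omega
    have hcp : c ∉ π := fun h => by have := hxp c h; omega
    have e1 : σ.Sublist (α.erase c) := by
      have := h2.erase c; rwa [List.erase_of_not_mem hcs] at this
    have e2 : π.Sublist (α.erase c) := by
      have := h3.erase c; rwa [List.erase_of_not_mem hcp] at this
    have e3 := length_add_le _ _ _ hdisj e1 e2
    have e4 := List.length_erase_of_mem hc
    have e5 := List.length_pos_of_mem hc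
    omega
  have key := main_R σ.reverse π.reverse hd x k
  rw [← (des_maj_rev σ x hxs).1, ← (des_maj_rev σ x hxs).2, ← (des_maj_rev π x hxp).1,
    ← (des_maj_rev π x hxp).2, List.length_reverse, List.length_reverse, hσl, hπl, hr, hs] at key
  have e : ∑ α ∈ S.filter (fun α => des α = k), (X : Polynomial ℚ) ^ maj α =
      B x (shufR σ.reverse π.reverse) k := by
    unfold B
    rw [Finset.sum_filter]
    refine Finset.sum_bij (fun α _ => α.reverse) (fun α h => (hrev α).1 h)
      (fun u _ v _ h => List.reverse_injective h)
      (fun β h => ⟨β.reverse, (hrev _).2 (by rwa [List.reverse_reverse]),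
        List.reverse_reverse β⟩) ?_
    intro α hα
    obtain ⟨h1, h2⟩ := des_maj_rev α x (hlet α hα)
    rw [h1, h2]
    simp only [Nat.cast_inj]
  rw [e, key, Phi]
  ring
end

section
/- For every n ≥ 0, ∑_{σ ∈ S_n} q^{maj(σ)} = [n]_q! as an identity of polynomials in q, where S_n is the set of all permutations of {1, 2, …, n} written as words. -/
open Polynomial List

/-- Appending a letter to a nonempty word. -/
lemma maj_append_two (l : List ℕ) (y x : ℕ) :
    maj (l ++ [y] ++ [x]) = maj (l ++ [y]) + if x < y then l.length + 1 else 0 := by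
  unfold maj descents
  rw [Finset.sum_filter, Finset.sum_filter]
  have h1 : (l ++ [y] ++ [x]).length = (l.length + 1) + 1 := by simp
  have h2 : (l ++ [y]).length = l.length + 1 := by simp
  rw [h1, Finset.sum_Ico_succ_top (by omega), h2]
  congr 1
  · apply Finset.sum_congr rfl
    intro i hi
    rw [Finset.mem_Ico] at hi
    rw [List.getD_append _ [x] _ i (by rw [h2]; omega),
      List.getD_append _ [x] _ (i - 1) (by rw [h2]; omega)]
  · rw [List.getD_append_right _ [x] _ (l.length + 1) (by rw [h2]),
      List.getD_append _ [x] _ (l.length + 1 - 1) (by rw [h2]; omega),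
      List.getD_append_right l [y] _ (l.length + 1 - 1) (by omega)]
    simp

/-- Major index generating monomial of the reversed word. -/
noncomputable def rf (w : List ℕ) : Polynomial ℚ := X ^ maj w.reverse

lemma rf_cons (x y : ℕ) (l : List ℕ) :
    rf (x :: y :: l) = rf (y :: l) * X ^ (if x < y then l.length + 1 else 0) := by
  unfold rf
  rw [List.reverse_cons, List.reverse_cons, maj_append_two, pow_add, List.length_reverse]

lemma rf_nil : rf [] = 1 := by simp [rf, maj, descents]

lemma rf_single (x : ℕ) : rf [x] = 1 := by simp [rf, maj, descents]

lemma sum_aux_tail (M : ℕ) (ys : List ℕ) : ∀ y, (∀ z ∈ y :: ys, z < M) →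
    (((List.permutations'Aux M ys).map (fun u => rf (y :: u))).sum : Polynomial ℚ) =
      rf (y :: ys) * (X * ∑ j ∈ Finset.range (ys.length + 1), (X : Polynomial ℚ) ^ j) := by
  induction ys with
  | nil =>
    intro y hy
    have : y < M := hy y (by simp)
    simp [rf_cons, rf_single, this]
  | cons z zs ih =>
    intro y hy
    have hyM : y < M := hy y (by simp)
    have hzM : z < M := hy z (by simp)
    have ih' := ih z (fun a ha => hy a (List.mem_cons_of_mem _ ha))
    have key : ((List.permutations'Aux M zs).map (fun u => rf (y :: z :: u))) =
        ((List.permutations'Aux M zs).map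
          (fun u => rf (z :: u) * X ^ (if y < z then zs.length + 2 else 0))) := by
      apply List.map_congr_left
      intro u hu
      have hl : u.length = zs.length + 1 := by
        have : u ∈ List.permutations' (M :: zs) := by
          rw [List.permutations', List.mem_flatMap]
          exact ⟨zs, by rw [List.mem_permutations'], hu⟩
        rw [List.mem_permutations'] at this
        simpa using this.length_eq
      rw [rf_cons, hl]
    rw [List.permutations'Aux, List.map_cons, List.sum_cons, List.map_map]
    have e : ((fun u => rf (y :: u)) ∘ List.cons z) = fun u => rf (y :: z :: u) := rfl
    rw [e, key, List.sum_map_mul_right, ih', rf_cons y M, rf_cons M z, rf_cons y z]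
    rw [if_pos hyM, if_neg (by omega : ¬ M < z)]
    simp only [List.length_cons]
    by_cases h : y < z
    · rw [if_pos h, if_pos h]
      have h1 : (∑ j ∈ Finset.range (zs.length + 1 + 1), (X : Polynomial ℚ) ^ j)
          = X * (∑ j ∈ Finset.range (zs.length + 1), (X : Polynomial ℚ) ^ j) + 1 := by
        rw [Finset.sum_range_succ', Finset.mul_sum]
        simp [pow_succ']
      rw [h1]; ring
    · rw [if_neg h, if_neg h, Finset.sum_range_succ _ (zs.length + 1)]
      ring

lemma sum_aux (M : ℕ) (w : List ℕ) (hw : ∀ z ∈ w, z < M) :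
    (((List.permutations'Aux M w).map rf).sum : Polynomial ℚ) =
      rf w * ∑ j ∈ Finset.range (w.length + 1), (X : Polynomial ℚ) ^ j := by
  cases w with
  | nil => simp [rf_nil, rf_single]
  | cons y ys =>
    have hyM : y < M := hw y (by simp)
    have h := sum_aux_tail M ys y hw
    rw [List.permutations'Aux, List.map_cons, List.sum_cons, List.map_map]
    have e : (rf ∘ List.cons y) = fun u => rf (y :: u) := rfl
    rw [e, h, rf_cons, if_neg (by omega : ¬ M < y), List.length_cons,
      Finset.sum_range_succ' _ (ys.length + 1), mul_add, Finset.mul_sum]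
    simp [pow_succ', add_comm]

/-- The word `n, n-1, …, 1`. -/
def down : ℕ → List ℕ
  | 0 => []
  | n + 1 => (n + 1) :: down n

lemma length_down (n : ℕ) : (down n).length = n := by
  induction n with
  | zero => rfl
  | succ n ih => simp [down, ih]

lemma mem_down (n x : ℕ) : x ∈ down n ↔ 1 ≤ x ∧ x ≤ n := by
  induction n with
  | zero => simp [down]; omega
  | succ n ih => simp only [down, List.mem_cons, ih]; omega

lemma nodup_down (n : ℕ) : (down n).Nodup := by
  induction n with
  | zero => simp [down]
  | succ n ih => simp [down, ih, mem_down]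

lemma sum_perms (n : ℕ) :
    (((List.permutations' (down n)).map rf).sum : Polynomial ℚ) =
      ∏ k ∈ Finset.Icc 1 n, ∑ j ∈ Finset.range k, (X : Polynomial ℚ) ^ j := by
  induction n with
  | zero => simp [down, rf_nil]
  | succ n ih =>
    rw [Finset.prod_Icc_succ_top (by omega), ← ih, down, List.permutations',
      List.map_flatMap, List.flatMap_def, List.sum_flatten, List.map_map, ← List.sum_map_mul_right]
    congr 1
    apply List.map_congr_left
    intro w hw
    rw [List.mem_permutations'] at hw
    have hl := hw.length_eq
    rw [length_down] at hl
    rw [Function.comp_apply, sum_aux, hl]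
    intro z hz
    have := (mem_down n z).1 (hw.mem_iff.1 hz)
    omega

/-- **MacMahon.** `∑_{σ ∈ S_n} q^{maj σ} = [n]_q!`. -/
theorem macmahon_maj (n : ℕ) (S : Finset (List ℕ))
    (hS : ∀ w, w ∈ S ↔ (w.Nodup ∧ w.length = n ∧ ∀ x, x ∈ w ↔ (1 ≤ x ∧ x ≤ n))) :
    ∑ w ∈ S, (X : Polynomial ℚ) ^ maj w =
      ∏ k ∈ Finset.Icc 1 n, ∑ j ∈ Finset.range k, (X : Polynomial ℚ) ^ j := by
  classical
  rw [← sum_perms]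
  have hnd : (List.permutations' (down n)).Nodup := 
    (List.permutations_perm_permutations' _).nodup_iff.1 (List.nodup_permutations _ (nodup_down n))
  rw [← List.sum_toFinset _ hnd]
  refine Finset.sum_nbij' List.reverse List.reverse ?_ ?_ ?_ ?_ ?_
  · intro w hw
    obtain ⟨h1, h2, h3⟩ := (hS w).1 hw
    rw [List.mem_toFinset, List.mem_permutations',
      List.perm_ext_iff_of_nodup (List.nodup_reverse.2 h1) (nodup_down n)]
    intro a
    rw [List.mem_reverse, h3, mem_down]
  · intro w hw
    rw [List.mem_toFinset, List.mem_permutations'] at hw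
    rw [hS]
    refine ⟨List.nodup_reverse.2 (hw.nodup_iff.2 (nodup_down n)), ?_, ?_⟩
    · rw [List.length_reverse, hw.length_eq, length_down]
    · intro x
      rw [List.mem_reverse, hw.mem_iff, mem_down]
  · intro w _; simp
  · intro w _; simp
  · intro w _; simp [rf]
end
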